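/- Fix an integer n ≥ 2 and define the weight w_n(j) = 2^{n-1} if j is odd and w_n(j) = 2^n if j is even. Let W_n(r) = Σ_{β ∈ S_r} Π_{cycles c of β} w_n(length of c), with cycles including fixed points as cycles of length 1, and W_n(0) = 1. Then for every integer r ≥ 2, W_n(r) = 2^{n-1} · W_n(r-1) + (r-1) · (r - 2 + 2^n) · W_n(r-2). (This is the recurrence r · Z_{S_r}(2^{n-1}, 2^n, …) = 2^{n-1} Z_{S_{r-1}}(2^{n-1}, 2^n, …) + (r - 2 + 2^n) Z_{S_{r-2}}(2^{n-1}, 2^n, …).) -/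

import Mathlib

/-- Orbit relation on `α` of the cyclic group generated by the permutation `σ`:
two points are related iff some power of `σ` maps one to the other. -/
def permOrbRel {α : Type*} (σ : Equiv.Perm α) (x y : α) : Prop :=
  ∃ k : ℤ, (σ ^ k) x = y

/-- Number of cycles of a permutation, counting fixed points as cycles of length 1:
the number of orbits of the subgroup generated by `σ`. -/
noncomputable def cycleCount {α : Type*} (σ : Equiv.Perm α) : ℕ :=
  Nat.card (Quot (permOrbRel σ))

/-- The size (length) of a cycle of a permutation, viewed as an orbit class. -/
noncomputable def orbSize {α : Type*} {r : α → α → Prop} (q : Quot r) : ℕ :=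
  Nat.card {x // Quot.mk r x = q}

/-- The weight `w_n(j)`: `2^(n-1)` for odd `j` and `2^n` for even `j`. -/
def wWeight (n j : ℕ) : ℕ := if Odd j then 2 ^ (n - 1) else 2 ^ n

/-- `W n r = Σ_{β ∈ S_r} Π_{cycles c of β} w_n(length of c)`, the cycle index
polynomial of `S_r` evaluated at `x_j = w_n(j)` and multiplied by `r!`. -/
noncomputable def W (n r : ℕ) : ℕ :=
  ∑ β : Equiv.Perm (Fin r), ∏ᶠ c : Quot (permOrbRel β), wWeight n (orbSize c)

theorem quot_mk_permOrbRel_eq_iff {α : Type*} {σ : Equiv.Perm α} {x y : α} :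
    Quot.mk (permOrbRel σ) x = Quot.mk (permOrbRel σ) y ↔ permOrbRel σ x y :=
  Quot.eq.trans (Equivalence.eqvGen_iff (Equiv.Perm.SameCycle.equivalence σ))

theorem quot_mk_permOrbRel_apply {α : Type*} (σ : Equiv.Perm α) (x : α) :
    Quot.mk (permOrbRel σ) (σ x) = Quot.mk (permOrbRel σ) x :=
  (Quot.sound ⟨1, by simp⟩).symm

theorem eq_of_permOrbRel {α β : Type*} {σ : Equiv.Perm α} {f : α → β}
    (hf : ∀ x, f (σ x) = f x) {x y : α} (h : permOrbRel σ x y) : f x = f y := by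
  have hpow : ∀ (k : ℕ) (z : α), f ((σ ^ k) z) = f z := by
    intro k
    induction k with
    | zero => simp
    | succ k ih => intro z; rw [pow_succ, Equiv.Perm.mul_apply, ih, hf]
  obtain ⟨k, rfl⟩ := h
  obtain ⟨k, rfl | rfl⟩ := k.eq_nat_or_neg
  · simp [hpow]
  · rw [← hpow k ((σ ^ (-(k : ℤ))) x)]
    simp

open Classical in
/-- The product over the cycles of `σ` of the value of `w` at the total mass of the cycle,
where the point `x` has mass `m x`. -/
noncomputable def massWeight {α : Type*} [Fintype α] (w : ℕ → ℕ) (m : α → ℕ)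
    (σ : Equiv.Perm α) : ℕ :=
  ∏ᶠ c : Quot (permOrbRel σ), w (∑ x, if Quot.mk _ x = c then m x else 0)

open Classical in
/-- The cycles of `σ` may be replaced by the fibres of any surjective invariant map which
separates the cycles. -/
theorem massWeight_eq_finprod {α β : Type*} [Fintype α] (w : ℕ → ℕ) (m : α → ℕ)
    (σ : Equiv.Perm α) (f : α → β) (hf : Function.Surjective f) (hσ : ∀ x, f (σ x) = f x)
    (hsep : ∀ x y, f x = f y → Quot.mk (permOrbRel σ) x = Quot.mk (permOrbRel σ) y) :
    massWeight w m σ = ∏ᶠ b : β, w (∑ x, if f x = b then m x else 0) := by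
  have hinj : Function.Injective (Quot.lift f fun _ _ h => eq_of_permOrbRel hσ h) := by
    rintro ⟨x⟩ ⟨y⟩ h
    exact hsep x y h
  refine finprod_eq_of_bijective (Quot.lift f fun _ _ h => eq_of_permOrbRel hσ h)
    ⟨hinj, fun b => ?_⟩ fun c => ?_
  · obtain ⟨x, rfl⟩ := hf b
    exact ⟨Quot.mk _ x, rfl⟩
  · refine congrArg w (Finset.sum_congr rfl fun x _ => ?_)
    exact if_congr (hinj.eq_iff (a := Quot.mk _ x)).symm rfl rfl

theorem massWeight_optionCongr {α : Type*} [Fintype α] (w : ℕ → ℕ) (m : Option α → ℕ)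
    (e : Equiv.Perm α) :
    massWeight w m (Equiv.optionCongr e) = w (m none) * massWeight w (m ∘ some) e := by
  classical
  have : Finite (Quot (permOrbRel e)) := Quot.finite _
  have := Fintype.ofFinite (Quot (permOrbRel e))
  rw [massWeight_eq_finprod w m _ (Option.map (Quot.mk (permOrbRel e))), massWeight,
    finprod_eq_prod_of_fintype, finprod_eq_prod_of_fintype, Fintype.prod_option]
  · simp [Fintype.sum_option]
  · rintro (_ | c)
    · exact ⟨none, rfl⟩
    · obtain ⟨x, rfl⟩ := Quot.exists_rep c
      exact ⟨some x, rfl⟩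
  · rintro (_ | x)
    · rfl
    · simpa using quot_mk_permOrbRel_apply e x
  · rintro (_ | x) (_ | y) h
    · rfl
    · simp at h
    · simp at h
    · refine eq_of_permOrbRel (f := fun x => Quot.mk (permOrbRel (Equiv.optionCongr e)) (some x))
        (fun x => ?_) (quot_mk_permOrbRel_eq_iff.1 (Option.some_injective _ h))
      exact quot_mk_permOrbRel_apply (Equiv.optionCongr e) (some x)

/-- Inserting `none` into the cycle of `p` moves the mass of `none` to `p`. -/
theorem massWeight_swap_mul_optionCongr {α : Type*} [Fintype α] [DecidableEq α] (w : ℕ → ℕ)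
    (m : Option α → ℕ) (e : Equiv.Perm α) (p : α) :
    massWeight w m (Equiv.swap none (some p) * Equiv.optionCongr e) =
      massWeight w (m ∘ some + Pi.single p (m none)) e := by
  classical
  set σ := Equiv.swap none (some p) * Equiv.optionCongr e with hσ
  have hnone : σ none = some p := by simp [hσ]
  have hsome : ∀ x, σ (some x) = if e x = p then none else some (e x) := by
    intro x
    by_cases h : e x = p <;> simp [hσ, h, Equiv.swap_apply_def]
  have hmk : Quot.mk (permOrbRel σ) none = Quot.mk (permOrbRel σ) (some p) := by
    rw [← hnone, quot_mk_permOrbRel_apply]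
  have hmk' : ∀ x, Quot.mk (permOrbRel σ) (some (e x)) = Quot.mk (permOrbRel σ) (some x) := by
    intro x
    rw [← quot_mk_permOrbRel_apply σ (some x), hsome]
    split_ifs with h
    · rw [h, hmk]
    · rfl
  rw [massWeight_eq_finprod w m σ (fun z => Quot.mk (permOrbRel e) (z.getD p)), massWeight]
  · refine finprod_congr fun c => congrArg w ?_
    have hsingle : ∀ x, (if Quot.mk (permOrbRel e) x = c then (Pi.single p (m none) : α → ℕ) x
        else 0) = if p = x then if Quot.mk (permOrbRel e) p = c then m none else 0 else 0 := by
      intro x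
      by_cases h : p = x
      · subst h; simp
      · simp [h, Ne.symm h]
    simp only [Fintype.sum_option, Pi.add_apply, ite_add_zero, Finset.sum_add_distrib, hsingle]
    simp [add_comm]
  · rintro ⟨x⟩
    exact ⟨some x, rfl⟩
  · rintro (_ | x)
    · simp [hnone]
    · refine Eq.trans (congrArg _ ?_) (quot_mk_permOrbRel_apply e x)
      rw [hsome]
      split_ifs with h <;> simp [h]
  · intro y z h
    have hgetD : ∀ z : Option α,
        Quot.mk (permOrbRel σ) z = Quot.mk (permOrbRel σ) (some (z.getD p)) := by
      rintro (_ | x)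
      · exact hmk
      · rfl
    rw [hgetD y, hgetD z]
    exact eq_of_permOrbRel (f := fun x => Quot.mk (permOrbRel σ) (some x)) hmk'
      (quot_mk_permOrbRel_eq_iff.1 h)

theorem massWeight_comp_permCongr {α β : Type*} [Fintype α] [Fintype β] (w : ℕ → ℕ) (m : β → ℕ)
    (φ : α ≃ β) (σ : Equiv.Perm α) :
    massWeight w m (φ.permCongr σ) = massWeight w (m ∘ φ) σ := by
  classical
  rw [massWeight_eq_finprod w m _ (fun y => Quot.mk (permOrbRel σ) (φ.symm y)), massWeight]
  · refine finprod_congr fun c => congrArg w ?_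
    rw [← φ.sum_comp]
    simp
  · exact Quot.mk_surjective.comp φ.symm.surjective
  · intro y
    simpa using quot_mk_permOrbRel_apply σ (φ.symm y)
  · intro y z h
    have := eq_of_permOrbRel (f := fun x => Quot.mk (permOrbRel (φ.permCongr σ)) (φ x))
      (fun x => by simpa using quot_mk_permOrbRel_apply (φ.permCongr σ) (φ x))
      (quot_mk_permOrbRel_eq_iff.1 h)
    simpa using this

/-- The sum of `massWeight w m σ` over all permutations `σ`. -/
noncomputable def massSum {α : Type*} [Fintype α] [DecidableEq α] (w : ℕ → ℕ) (m : α → ℕ) : ℕ :=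
  ∑ σ : Equiv.Perm α, massWeight w m σ

theorem massSum_comp_equiv {α β : Type*} [Fintype α] [Fintype β] [DecidableEq α]
    [DecidableEq β] (w : ℕ → ℕ) (m : β → ℕ) (φ : α ≃ β) : massSum w (m ∘ φ) = massSum w m :=
  Fintype.sum_equiv φ.permCongr _ _ fun σ => (massWeight_comp_permCongr w m φ σ).symm

theorem massSum_option {α : Type*} [Fintype α] [DecidableEq α] (w : ℕ → ℕ) (m : Option α → ℕ) :
    massSum w m = w (m none) * massSum w (m ∘ some) +
      ∑ p, massSum w (m ∘ some + Pi.single p (m none)) := by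
  rw [massSum, ← Fintype.sum_equiv Equiv.Perm.decomposeOption.symm
    (fun x => massWeight w m (Equiv.Perm.decomposeOption.symm x)) _ fun _ => rfl,
    Fintype.sum_prod_type, Fintype.sum_option]
  simp only [Equiv.Perm.decomposeOption_symm_apply, massWeight_swap_mul_optionCongr,
    Equiv.swap_self, ← Equiv.Perm.one_def, one_mul, massWeight_optionCongr]
  rw [← Finset.mul_sum]
  simp only [massSum]

theorem massSum_add_single {α : Type*} [Fintype α] [DecidableEq α] (w : ℕ → ℕ) (p q : α) :
    massSum w (1 + Pi.single p 1) = massSum w (1 + Pi.single q 1) := by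
  rw [← massSum_comp_equiv w (1 + Pi.single q 1) (Equiv.swap p q)]
  congr 1
  ext x
  simp only [Pi.add_apply, Function.comp_apply, Pi.single_apply, Equiv.swap_apply_eq_iff,
    Equiv.swap_apply_right, Pi.one_apply]

/-- The two-term recurrence for a weight of period two. -/
theorem massSum_one_option_option {α : Type*} [Fintype α] [DecidableEq α] (w : ℕ → ℕ)
    (hw : ∀ j, w (j + 2) = w j) :
    massSum w (1 : Option (Option α) → ℕ) = w 1 * massSum w (1 : Option α → ℕ) +
      (Fintype.card α + 1) * (Fintype.card α + w 2) * massSum w (1 : α → ℕ) := by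
  have hmod : ∀ j, w j = w (j % 2) := fun j =>
    ((show Function.Periodic w 2 from hw).map_mod_nat j).symm
  have hparity : ∀ p : α, massSum w (1 + Pi.single p 2) = massSum w (1 : α → ℕ) := by
    intro p
    refine Finset.sum_congr rfl fun σ _ => finprod_congr fun c => ?_
    rw [hmod, hmod (∑ x, _)]
    congr 1
    refine Nat.ModEq.sum fun x _ => ?_
    by_cases h : x = p <;> split_ifs <;> simp [h, Nat.ModEq]
  have hnone : massSum w (1 + Pi.single none 1 : Option α → ℕ) =
      (Fintype.card α + w 2) * massSum w (1 : α → ℕ) := by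
    have hcomp : (1 + Pi.single none 1 : Option α → ℕ) ∘ some = 1 := by
      ext x; simp
    rw [massSum_option, hcomp]
    simp [hparity]
    ring
  rw [massSum_option]
  simp only [Pi.one_apply, Pi.one_comp]
  rw [Finset.sum_congr rfl fun p _ => massSum_add_single w p none, hnone]
  simp
  ring

theorem W_eq_massSum (n r : ℕ) : W n r = massSum (wWeight n) (1 : Fin r → ℕ) := by
  classical
  unfold W massSum
  congr! with β
  refine finprod_congr fun c => congrArg _ ?_
  simp [orbSize, Nat.card_eq_fintype_card, Fintype.card_subtype]

/-- The recurrence `r · Z_{S_r}(2^{n-1}, 2^n, …) = 2^{n-1} Z_{S_{r-1}}(…) +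
(r - 2 + 2^n) Z_{S_{r-2}}(…)` for `n ≥ 2` and `r ≥ 2`, stated as
`W_n(r) = 2^{n-1} · W_n(r-1) + (r-1) · (r - 2 + 2^n) · W_n(r-2)`. -/
theorem W_recurrence (n : ℕ) (hn : 2 ≤ n) (r : ℕ) (hr : 2 ≤ r) :
    W n r = 2 ^ (n - 1) * W n (r - 1) + (r - 1) * (r - 2 + 2 ^ n) * W n (r - 2) := by
  obtain ⟨r, rfl⟩ := Nat.exists_eq_add_of_le' hr
  have hw : ∀ j, wWeight n (j + 2) = wWeight n j := fun j => by
    simp [wWeight, Nat.odd_add]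
  have h₁ : W n (r + 1) = massSum (wWeight n) (1 : Option (Fin r) → ℕ) :=
    (W_eq_massSum n _).trans (massSum_comp_equiv _ 1 (finSuccEquiv r))
  have h₂ : W n (r + 2) = massSum (wWeight n) (1 : Option (Option (Fin r)) → ℕ) :=
    (W_eq_massSum n _).trans (massSum_comp_equiv _ 1
      ((finSuccEquiv (r + 1)).trans (Equiv.optionCongr (finSuccEquiv r))))
  have h := massSum_one_option_option (α := Fin r) (wWeight n) hw
  rw [← h₁, ← h₂, ← W_eq_massSum, Fintype.card_fin] at h
  simpa [wWeight, show ¬ Odd 2 by decide] using h
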